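/- Let h be an invertible (n+1)×(n+1) complex matrix with h*J₀h = J₀. Suppose h·e₀ is a scalar multiple of e₀ and h·eₙ is a scalar multiple of eₙ (i.e. h fixes both the cusp q_∞ = [e₀] and the cusp q₀ = [eₙ] projectively). Then every entry of h outside the (0,0) entry, the (n,n) entry, and the middle (n−1)×(n−1) block A = (h(i,j))_{0<i,j<n} vanishes; the middle block satisfies A*A = I_{n−1}; and h(n,n) = 1/conj(h(0,0)). -/

import Mathlib

open Matrix Complex

/-- The matrix `J₀` of the Hermitian form of signature `(n,1)` in the Siegel-domain model. -/
noncomputable def J0 (n : ℕ) : Matrix (Fin (n+1)) (Fin (n+1)) ℂ :=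
  Matrix.of fun i j =>
    if i.val = 0 ∧ j.val = n then 1
    else if i.val = n ∧ j.val = 0 then 1
    else if i = j ∧ 0 < i.val ∧ i.val < n then 1
    else 0

/-- Extend a vector `ζ ∈ ℂ^{n-1}` to the middle coordinates `1,…,n-1` of `ℂ^{n+1}`. -/
noncomputable def pad (n : ℕ) (ζ : Fin (n-1) → ℂ) (i : Fin (n+1)) : ℂ :=
  if h : 0 < i.val ∧ i.val < n then ζ ⟨i.val - 1, by omega⟩ else 0

/-- The embedding `ψ` of the Siegel domain (horospherical coordinates) into `ℂ^{n+1}`: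
`ψ(ζ,v,u)` has 0-th coordinate `(−‖ζ‖² − u + iv)/2`, middle coordinates `ζ`,
and last coordinate `1`. -/
noncomputable def psi (n : ℕ) (ζ : Fin (n-1) → ℂ) (v u : ℝ) : Fin (n+1) → ℂ :=
  fun i =>
    if i.val = 0 then (((-(∑ j, Complex.normSq (ζ j)) - u : ℝ) : ℂ) + (v : ℂ) * Complex.I) / 2
    else if i.val = n then 1
    else pad n ζ i

/-- The standard basis vector `e₀ = (1,0,…,0)ᵀ` of `ℂ^{n+1}`. -/
noncomputable def e0 (n : ℕ) : Fin (n+1) → ℂ := Pi.single 0 1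

/-- The standard basis vector `eₙ = (0,…,0,1)ᵀ` of `ℂ^{n+1}`. -/
noncomputable def eLast (n : ℕ) : Fin (n+1) → ℂ := Pi.single (Fin.last n) 1

/-- The inclusion of an index of `ℂ^{n-1}` into the middle indices `1,…,n-1` of `ℂ^{n+1}`. -/
def midIdx (n : ℕ) (i : Fin (n-1)) : Fin (n+1) := ⟨i.val + 1, by have := i.isLt; omega⟩

/-- The sesquilinear form of `J₀` splits into the two isotropic cross terms and the standard
Hermitian form on the middle coordinates. -/
theorem conjTranspose_mul_J0_mul_apply (m : ℕ) (h : Matrix (Fin (m+1+1)) (Fin (m+1+1)) ℂ)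
    (a b : Fin (m+1+1)) :
    (hᴴ * J0 (m+1) * h) a b =
      star (h 0 a) * h (Fin.last (m+1)) b + star (h (Fin.last (m+1)) a) * h 0 b +
        ∑ i : Fin m, star (h (midIdx (m+1) i) a) * h (midIdx (m+1) i) b := by
  have hmid (i : Fin m) : i.castSucc.succ = midIdx (m+1) i := rfl
  have hlast : (Fin.last m).succ = Fin.last (m+1) := rfl
  have h0 (j : Fin (m+1+1)) : (hᴴ * J0 (m+1)) a j =
      if j = 0 then star (h (Fin.last (m+1)) a)
      else if j = Fin.last (m+1) then star (h 0 a) else star (h j a) := by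
    rw [Matrix.mul_apply]
    have key (k : Fin (m+1+1)) : J0 (m+1) k j =
        if k = (if j = 0 then Fin.last (m+1) else if j = Fin.last (m+1) then 0 else j)
        then 1 else 0 := by
      simp only [J0, Matrix.of_apply]
      split_ifs <;> simp only [Fin.ext_iff, Fin.val_zero, Fin.val_last] at * <;>
        first | rfl | omega
    simp only [key, mul_ite, mul_one, mul_zero, Finset.sum_ite_eq',
      Finset.mem_univ, if_true, Matrix.conjTranspose_apply]
    split_ifs <;> rfl
  rw [Matrix.mul_apply, Fin.sum_univ_succ, Fin.sum_univ_castSucc]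
  simp only [h0, hmid, hlast]
  have e1 (i : Fin m) : midIdx (m+1) i ≠ 0 := by simp [midIdx, Fin.ext_iff]
  have e2 (i : Fin m) : midIdx (m+1) i ≠ Fin.last (m+1) := by
    have := i.isLt
    simp only [midIdx, ne_eq, Fin.ext_iff, Fin.val_last]
    omega
  have e3 : Fin.last (m+1) ≠ 0 := by simp [Fin.ext_iff]
  simp only [e1, e2, e3, if_true, if_false]
  ring

/-- A matrix preserving the line of a standard basis vector has no off-diagonal entry in the
corresponding column. -/
theorem apply_eq_zero_of_mulVec_single {ι : Type*} [Fintype ι] [DecidableEq ι]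
    {h : Matrix ι ι ℂ} {k : ι} {c : ℂ}
    (hc : h *ᵥ Pi.single k 1 = c • (Pi.single k 1 : ι → ℂ)) {i : ι} (hi : i ≠ k) :
    h i k = 0 := by
  have := congrFun hc i
  simpa [hi] using this

/-- If `h ∈ U(J₀)` fixes both cusps `q_∞ = [e₀]` and `q₀ = [eₙ]` projectively, then all
entries outside the `(0,0)` entry, the `(n,n)` entry, and the middle `(n−1)×(n−1)` block `A`
vanish, the middle block satisfies `A*A = I`, and `h(n,n) = 1/conj(h(0,0))`. -/
theorem statement_3 (n : ℕ) (hn : 1 ≤ n) (h : Matrix (Fin (n+1)) (Fin (n+1)) ℂ)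
    (hinv : IsUnit h) (hJ : hᴴ * J0 n * h = J0 n)
    (hfix0 : ∃ μ : ℂ, h *ᵥ e0 n = μ • e0 n)
    (hfixn : ∃ ν : ℂ, h *ᵥ eLast n = ν • eLast n) :
    (∀ i j : Fin (n+1),
        ¬((i.val = 0 ∧ j.val = 0) ∨ (i.val = n ∧ j.val = n) ∨
          (0 < i.val ∧ i.val < n ∧ 0 < j.val ∧ j.val < n)) → h i j = 0) ∧
    (Matrix.of fun i j : Fin (n-1) => h (midIdx n i) (midIdx n j))ᴴ *
      (Matrix.of fun i j : Fin (n-1) => h (midIdx n i) (midIdx n j)) = 1 ∧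
    h (Fin.last n) (Fin.last n) = ((starRingEnd ℂ) (h 0 0))⁻¹ := by
  obtain ⟨m, rfl⟩ : ∃ m, n = m + 1 := ⟨n - 1, by omega⟩
  obtain ⟨μ, hμ⟩ := hfix0
  obtain ⟨ν, hν⟩ := hfixn
  have c0 {i : Fin (m+1+1)} (hi : i ≠ 0) : h i 0 = 0 := apply_eq_zero_of_mulVec_single hμ hi
  have cL {i : Fin (m+1+1)} (hi : i ≠ Fin.last (m+1)) : h i (Fin.last (m+1)) = 0 :=
    apply_eq_zero_of_mulVec_single hν hi
  have e1 (i : Fin m) : midIdx (m+1) i ≠ 0 := by simp [midIdx, Fin.ext_iff]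
  have e2 (i : Fin m) : midIdx (m+1) i ≠ Fin.last (m+1) := by
    have := i.isLt
    simp only [midIdx, ne_eq, Fin.ext_iff, Fin.val_last]
    omega
  have e3 : Fin.last (m+1) ≠ 0 := by simp [Fin.ext_iff]
  have form (a b : Fin (m+1+1)) := (conjTranspose_mul_J0_mul_apply m h a b).symm.trans
    (congrFun (congrFun hJ a) b)
  have row0 (b : Fin (m+1+1)) : star (h 0 0) * h (Fin.last (m+1)) b = J0 (m+1) 0 b := by
    simpa [c0 e3, c0 (e1 _)] using form 0 b
  have rowL (b : Fin (m+1+1)) : star (h (Fin.last (m+1)) (Fin.last (m+1))) * h 0 b =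
      J0 (m+1) (Fin.last (m+1)) b := by
    simpa [cL e3.symm, cL (e2 _)] using form (Fin.last (m+1)) b
  have corner : star (h 0 0) * h (Fin.last (m+1)) (Fin.last (m+1)) = 1 := by
    simpa [J0] using row0 (Fin.last (m+1))
  have n0 : star (h 0 0) ≠ 0 := left_ne_zero_of_mul_eq_one corner
  have nL : star (h (Fin.last (m+1)) (Fin.last (m+1))) ≠ 0 :=
    star_ne_zero.mpr (right_ne_zero_of_mul_eq_one corner)
  have zL {b : Fin (m+1+1)} (hb : b ≠ Fin.last (m+1)) : h (Fin.last (m+1)) b = 0 := by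
    refine (mul_eq_zero.mp ((row0 b).trans ?_)).resolve_left n0
    have : b.val ≠ m + 1 := fun hb' => hb (Fin.ext hb')
    simp [J0, this]
  have z0 {b : Fin (m+1+1)} (hb : b ≠ 0) : h 0 b = 0 := by
    refine (mul_eq_zero.mp ((rowL b).trans ?_)).resolve_left nL
    simp [J0, hb]
  refine ⟨fun i j hij => ?_, ?_, eq_inv_of_mul_eq_one_right corner⟩
  · have hi := i.isLt
    have hj := j.isLt
    by_cases i0 : i = 0
    · subst i0
      exact z0 fun hj0 => hij (by simp [hj0])
    by_cases iL : i = Fin.last (m+1)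
    · subst iL
      exact zL fun hjL => hij (by simp [hjL])
    by_cases j0 : j = 0
    · exact j0 ▸ c0 i0
    by_cases jL : j = Fin.last (m+1)
    · exact jL ▸ cL iL
    simp only [Fin.ext_iff, Fin.val_zero, Fin.val_last] at i0 iL j0 jL
    omega
  · ext a b
    have hab := form (midIdx (m+1) a) (midIdx (m+1) b)
    rw [z0 (e1 a), z0 (e1 b), star_zero, zero_mul, mul_zero, add_zero, zero_add] at hab
    refine hab.trans ?_
    have := a.isLt
    simp only [J0, midIdx, Matrix.of_apply, Matrix.one_apply, Fin.ext_iff]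
    split_ifs <;> first | rfl | omega
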